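/- arXiv:1411.4089 — 2 statements merged into one kernel-verified Lean document; each statement's English description precedes it below -/
import Mathlib

section
/- Let p, q be integers with q ≥ p ≥ 1, n = p + q, and d ∈ {1,2,4}. Then for every μ ∈ Λ⁺(B), the function λ ↦ (λ+1)·η_μ(λ) has a finite limit as λ → −1 (along the punctured neighborhood of −1 intersected with the domain of η_μ); moreover for μ = (0,…,0) this limit is nonzero. (That is, the cosine-λ transform has a simple pole at λ = −1.) -/
open Filter Set

/-- `x` is a nonpositive integer (a pole of the Gamma function). -/
def IsNonposInt (x : ℝ) : Prop := ∃ k : ℕ, x = -(k : ℝ)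

/-- The eigenvalue `η_μ(λ)` of the cosine-λ transform on `Gr(p, 𝕂^{p+q})`
(`d = dim_ℝ 𝕂`) on the K-type of highest weight `μ = m`. -/
noncomputable def eta (d p q : ℕ) (m : Fin p → ℤ) (l : ℝ) : ℝ :=
  (-1 : ℝ) ^ ((∑ j, m j) / 2) *
    ((∏ j : Fin p,
        Real.Gamma ((d : ℝ) * ((p : ℝ) + (q : ℝ)) / 2 - (d : ℝ) * ((j : ℕ) : ℝ) / 2)) /
      (∏ j : Fin p, Real.Gamma ((d : ℝ) * (p : ℝ) / 2 - (d : ℝ) * ((j : ℕ) : ℝ) / 2))) *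
    (∏ j : Fin p,
      Real.Gamma ((d : ℝ) * (l + (p : ℝ)) / 2 - (d : ℝ) * ((j : ℕ) : ℝ) / 2) *
        Real.Gamma ((-(d : ℝ) * l + (m j : ℝ)) / 2 - (d : ℝ) * ((j : ℕ) : ℝ) / 2)) /
    (∏ j : Fin p,
      Real.Gamma (-(d : ℝ) * l / 2 - (d : ℝ) * ((j : ℕ) : ℝ) / 2) *
        Real.Gamma
          (((d : ℝ) * l + (d : ℝ) * ((p : ℝ) + (q : ℝ)) + (m j : ℝ)) / 2 -
            (d : ℝ) * ((j : ℕ) : ℝ) / 2))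

/-- Domain of `η_μ`: the set of real `λ` at which no Gamma argument appearing in the
formula for `η_μ(λ)` is a nonpositive integer. -/
def etaDom (d p q : ℕ) (m : Fin p → ℤ) : Set ℝ :=
  {l | ∀ j : Fin p,
    ¬ IsNonposInt ((d : ℝ) * (l + (p : ℝ)) / 2 - (d : ℝ) * ((j : ℕ) : ℝ) / 2) ∧
    ¬ IsNonposInt ((-(d : ℝ) * l + (m j : ℝ)) / 2 - (d : ℝ) * ((j : ℕ) : ℝ) / 2) ∧
    ¬ IsNonposInt (-(d : ℝ) * l / 2 - (d : ℝ) * ((j : ℕ) : ℝ) / 2) ∧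
    ¬ IsNonposInt
        (((d : ℝ) * l + (d : ℝ) * ((p : ℝ) + (q : ℝ)) + (m j : ℝ)) / 2 -
          (d : ℝ) * ((j : ℕ) : ℝ) / 2)}

/-- Membership in `Λ⁺(B)`: all `m_i` even, `m₁ ≥ m₂ ≥ ⋯ ≥ m_{p-1} ≥ |m_p|`, and
`m_p ≥ 0` unless `d = 1` and `p = q`. -/
def LambdaPlus (d p q : ℕ) (m : Fin p → ℤ) : Prop :=
  (∀ i, 2 ∣ m i) ∧ (∀ i j : Fin p, i < j → |m j| ≤ m i) ∧
    (¬(d = 1 ∧ p = q) → ∀ i, 0 ≤ m i)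

open Topology

theorem Real.Gamma_add_natCast_eq_prod (k : ℕ) {x : ℝ} (hx : ¬ IsNonposInt x) :
    Real.Gamma (x + k) = (∏ i ∈ Finset.range k, (x + i)) * Real.Gamma x := by
  induction k with
  | zero => simp
  | succ k ih =>
    have hk : x + k ≠ 0 := fun h => hx ⟨k, by linarith⟩
    rw [Finset.prod_range_succ, Nat.cast_succ, ← add_assoc, Real.Gamma_add_one hk, ih]
    ring

theorem Real.Gamma_ne_zero_of_not_isNonposInt {x : ℝ} (hx : ¬ IsNonposInt x) :
    Real.Gamma x ≠ 0 :=
  Real.Gamma_ne_zero fun k h => hx ⟨k, h⟩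

/-- The reciprocal Gamma function is continuous on the whole real line. -/
theorem Real.continuous_inv_Gamma : Continuous fun x : ℝ => (Real.Gamma x)⁻¹ := by
  have h : (fun x : ℝ => (Real.Gamma x)⁻¹) = fun x : ℝ => ((Complex.Gamma x)⁻¹).re := by
    funext x
    rw [Complex.Gamma_ofReal, ← Complex.ofReal_inv, Complex.ofReal_re]
  rw [h]
  exact Complex.continuous_re.comp
    (Complex.differentiable_one_div_Gamma.continuous.comp Complex.continuous_ofReal)

/-- The quotient `Γ(x + k) / Γ(x)` has finite limits away from the positive integers, and
everywhere if `k ≥ 0`. -/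
theorem exists_tendsto_Gamma_add_intCast_div {k : ℤ} {x₀ : ℝ} (h : 0 ≤ k ∨ x₀ < 1) :
    ∃ c, Tendsto (fun x : ℝ => Real.Gamma (x + k) / Real.Gamma x)
      (𝓝[{x | ¬ IsNonposInt (x + k) ∧ ¬ IsNonposInt x}] x₀) (𝓝 c) := by
  obtain hk | hk := le_or_gt 0 k
  · lift k to ℕ using hk
    have hc : Continuous fun x : ℝ => ∏ i ∈ Finset.range k, (x + i) := by fun_prop
    refine ⟨_, (hc.tendsto x₀).mono_left nhdsWithin_le_nhds |>.congr' ?_⟩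
    filter_upwards [self_mem_nhdsWithin] with x hx
    rw [Int.cast_natCast, Real.Gamma_add_natCast_eq_prod k hx.2,
      mul_div_cancel_right₀ _ (Real.Gamma_ne_zero_of_not_isNonposInt hx.2)]
  · have hx₀ : x₀ < 1 := h.resolve_left hk.not_ge
    obtain ⟨r, rfl⟩ : ∃ r : ℕ, k = -(r : ℤ) := ⟨k.natAbs, by omega⟩
    have hc : ContinuousAt
        (fun x : ℝ => (∏ i ∈ Finset.range r, (x + ((-(r : ℤ) : ℤ) : ℝ) + i))⁻¹) x₀ := by
      refine ContinuousAt.inv₀ (by fun_prop) (Finset.prod_ne_zero_iff.2 fun i hi => ?_)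
      have : (i : ℝ) + 1 ≤ r := by exact_mod_cast Finset.mem_range.1 hi
      push_cast
      linarith
    refine ⟨_, (hc.tendsto.mono_left nhdsWithin_le_nhds).congr' ?_⟩
    filter_upwards [self_mem_nhdsWithin] with x hx
    have hG := Real.Gamma_add_natCast_eq_prod r hx.1
    have hx' : x + ((-(r : ℤ) : ℤ) : ℝ) + r = x := by push_cast; ring
    rw [hx'] at hG
    rw [hG, div_mul_cancel_right₀ (Real.Gamma_ne_zero_of_not_isNonposInt hx.1)]

theorem Real.tendsto_self_mul_Gamma_nhdsNE_zero :
    Tendsto (fun x : ℝ => x * Real.Gamma x) (𝓝[≠] 0) (𝓝 1) := by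
  have hG : ContinuousAt (fun x : ℝ => Real.Gamma (x + 1)) 0 := by
    refine ContinuousAt.comp (g := Real.Gamma) ?_ (by fun_prop)
    rw [zero_add]
    exact (Real.differentiableAt_Gamma fun k => by
      have : (0 : ℝ) ≤ k := k.cast_nonneg
      linarith).continuousAt
  have h := hG.tendsto.mono_left (nhdsWithin_le_nhds (s := {0}ᶜ))
  rw [zero_add, Real.Gamma_one] at h
  refine h.congr' ?_
  filter_upwards [self_mem_nhdsWithin] with x hx
  exact Real.Gamma_add_one hx

theorem exists_ne_zero_tendsto_add_one_mul_prod_Gamma {d p : ℕ} (hd : 0 < d) (hp : 1 ≤ p) :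
    ∃ c : ℝ, c ≠ 0 ∧ Tendsto (fun l : ℝ => (l + 1) * ∏ j : Fin p,
        Real.Gamma ((d : ℝ) * (l + (p : ℝ)) / 2 - (d : ℝ) * ((j : ℕ) : ℝ) / 2))
      (𝓝[≠] (-1)) (𝓝 c) := by
  have hd' : (0 : ℝ) < d := by exact_mod_cast hd
  obtain ⟨r, rfl⟩ : ∃ r, p = r + 1 := ⟨p - 1, by omega⟩
  have hprod : ∀ i : Fin r,
      0 < (d : ℝ) * (-1 + ((r + 1 : ℕ) : ℝ)) / 2 - (d : ℝ) * ((i : ℕ) : ℝ) / 2 := by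
    intro i
    have : ((i : ℕ) : ℝ) < r := by exact_mod_cast i.2
    push_cast
    nlinarith
  have hreg : Tendsto (fun l : ℝ => ∏ i : Fin r,
      Real.Gamma ((d : ℝ) * (l + ((r + 1 : ℕ) : ℝ)) / 2 - (d : ℝ) * ((i : ℕ) : ℝ) / 2))
      (𝓝[≠] (-1)) (𝓝 (∏ i : Fin r, Real.Gamma
        ((d : ℝ) * (-1 + ((r + 1 : ℕ) : ℝ)) / 2 - (d : ℝ) * ((i : ℕ) : ℝ) / 2))) := by
    refine tendsto_finsetProd _ fun i _ => Tendsto.mono_left ?_ nhdsWithin_le_nhds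
    have hG := (Real.differentiableAt_Gamma fun k h => by
      have := hprod i
      rw [h] at this
      have : (0 : ℝ) ≤ k := k.cast_nonneg
      linarith : DifferentiableAt ℝ Real.Gamma
        ((d : ℝ) * (-1 + ((r + 1 : ℕ) : ℝ)) / 2 - (d : ℝ) * ((i : ℕ) : ℝ) / 2)).continuousAt
    have hl : Continuous fun l : ℝ =>
      (d : ℝ) * (l + ((r + 1 : ℕ) : ℝ)) / 2 - (d : ℝ) * ((i : ℕ) : ℝ) / 2 := by fun_prop
    exact hG.tendsto.comp (hl.tendsto (-1))
  have hlin : Tendsto (fun l : ℝ => (d : ℝ) * (l + 1) / 2) (𝓝[≠] (-1)) (𝓝[≠] 0) := by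
    refine tendsto_nhdsWithin_iff.2 ⟨?_, ?_⟩
    · have hl : Continuous fun l : ℝ => (d : ℝ) * (l + 1) / 2 := by fun_prop
      simpa using (hl.tendsto (-1)).mono_left nhdsWithin_le_nhds
    · filter_upwards [self_mem_nhdsWithin] with l hl
      have : l + 1 ≠ 0 := fun h => hl (by simp only [mem_singleton_iff]; linarith)
      simp [hd'.ne', this]
  have hpole := (Real.tendsto_self_mul_Gamma_nhdsNE_zero.comp hlin).const_mul (2 / (d : ℝ))
  refine ⟨_, ?_, (hpole.mul hreg).congr fun l => ?_⟩
  · exact mul_ne_zero (by positivity)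
      (Finset.prod_ne_zero_iff.2 fun i _ => (Real.Gamma_pos_of_pos (hprod i)).ne')
  · rw [Fin.prod_univ_castSucc]
    have hlast : (d : ℝ) * (l + ((r + 1 : ℕ) : ℝ)) / 2 - (d : ℝ) * ((Fin.last r : ℕ) : ℝ) / 2
        = (d : ℝ) * (l + 1) / 2 := by
      rw [Fin.val_last]; push_cast; ring
    rw [hlast]
    simp only [Function.comp_apply, Fin.val_castSucc]
    field_simp

/-- Limits of the Gamma factors of `eta` combine to a limit of `(λ + 1) η_μ(λ)`. -/
theorem tendsto_add_one_mul_eta {d p q : ℕ} {m : Fin p → ℤ} {a : ℝ} {R : Fin p → ℝ}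
    (ha : Tendsto (fun l : ℝ => (l + 1) * ∏ j : Fin p,
        Real.Gamma ((d : ℝ) * (l + (p : ℝ)) / 2 - (d : ℝ) * ((j : ℕ) : ℝ) / 2))
      (𝓝[≠] (-1)) (𝓝 a))
    (hR : ∀ j : Fin p, Tendsto (fun l : ℝ =>
        Real.Gamma ((-(d : ℝ) * l + (m j : ℝ)) / 2 - (d : ℝ) * ((j : ℕ) : ℝ) / 2) /
          Real.Gamma (-(d : ℝ) * l / 2 - (d : ℝ) * ((j : ℕ) : ℝ) / 2))
      (𝓝[etaDom d p q m \ {-1}] (-1)) (𝓝 (R j))) :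
    Tendsto (fun l : ℝ => (l + 1) * eta d p q m l) (𝓝[etaDom d p q m \ {-1}] (-1))
      (𝓝 ((-1 : ℝ) ^ ((∑ j, m j) / 2) *
        ((∏ j : Fin p,
            Real.Gamma ((d : ℝ) * ((p : ℝ) + (q : ℝ)) / 2 - (d : ℝ) * ((j : ℕ) : ℝ) / 2)) /
          (∏ j : Fin p, Real.Gamma ((d : ℝ) * (p : ℝ) / 2 - (d : ℝ) * ((j : ℕ) : ℝ) / 2))) *
        a * (∏ j, R j) * ∏ j : Fin p, (Real.Gamma
          (((d : ℝ) * (-1) + (d : ℝ) * ((p : ℝ) + (q : ℝ)) + (m j : ℝ)) / 2 -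
            (d : ℝ) * ((j : ℕ) : ℝ) / 2))⁻¹)) := by
  have hD : Continuous fun l : ℝ => ∏ j : Fin p, (Real.Gamma
      (((d : ℝ) * l + (d : ℝ) * ((p : ℝ) + (q : ℝ)) + (m j : ℝ)) / 2 -
        (d : ℝ) * ((j : ℕ) : ℝ) / 2))⁻¹ :=
    continuous_finsetProd _ fun j _ => Real.continuous_inv_Gamma.comp (by fun_prop)
  have ha' := ha.mono_left (nhdsWithin_mono (-1) fun l (hl : l ∈ etaDom d p q m \ {-1}) => hl.2)
  refine (((ha'.const_mul _).mul (tendsto_finsetProd Finset.univ fun j _ => hR j)).mul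
    ((hD.tendsto (-1)).mono_left nhdsWithin_le_nhds)).congr fun l => ?_
  simp only [eta, Finset.prod_mul_distrib, Finset.prod_div_distrib, Finset.prod_inv_distrib]
  rw [← div_eq_mul_inv, mul_div_assoc', div_div, mul_div_assoc']
  ring

theorem LambdaPlus.nonneg_or {d p q : ℕ} {m : Fin p → ℤ} (hm : LambdaPlus d p q m) (j : Fin p) :
    0 ≤ m j ∨ d = 1 ∧ (j : ℕ) + 1 = p := by
  by_cases hj : (j : ℕ) + 1 = p
  · by_cases h : d = 1 ∧ p = q
    · exact Or.inr ⟨h.1, hj⟩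
    · exact Or.inl (hm.2.2 h j)
  · have := j.2
    exact Or.inl ((abs_nonneg _).trans
      (hm.2.1 j ⟨j + 1, by omega⟩ (Fin.lt_def.2 (Nat.lt_succ_self _))))

/-- the cosine-λ transform has a simple pole at λ = -1: for every
`μ ∈ Λ⁺(B)` the function `(λ+1)·η_μ(λ)` has a finite limit at λ = -1, nonzero for μ = 0. -/
theorem simple_pole_at_neg_one
    (d p q : ℕ) (hd : d = 1 ∨ d = 2 ∨ d = 4) (hp : 1 ≤ p) (hpq : p ≤ q) :
    (∀ m : Fin p → ℤ, LambdaPlus d p q m →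
      ∃ c : ℝ, Tendsto (fun l : ℝ => (l + 1) * eta d p q m l)
        (nhdsWithin (-1) (etaDom d p q m \ {-1})) (nhds c)) ∧
    (∃ c : ℝ, c ≠ 0 ∧
      Tendsto (fun l : ℝ => (l + 1) * eta d p q (fun _ => 0) l)
        (nhdsWithin (-1) (etaDom d p q (fun _ => 0) \ {-1})) (nhds c)) := by
  have hd0 : 0 < d := by omega
  obtain ⟨a, ha0, ha⟩ := exists_ne_zero_tendsto_add_one_mul_prod_Gamma hd0 hp
  constructor
  · intro m hm
    have key : ∀ j : Fin p, ∃ c, Tendsto (fun l : ℝ =>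
        Real.Gamma ((-(d : ℝ) * l + (m j : ℝ)) / 2 - (d : ℝ) * ((j : ℕ) : ℝ) / 2) /
          Real.Gamma (-(d : ℝ) * l / 2 - (d : ℝ) * ((j : ℕ) : ℝ) / 2))
        (𝓝[etaDom d p q m \ {-1}] (-1)) (𝓝 c) := by
      intro j
      obtain ⟨k, hk⟩ := hm.1 j
      have hshift : ∀ l : ℝ, (-(d : ℝ) * l + (m j : ℝ)) / 2 - (d : ℝ) * ((j : ℕ) : ℝ) / 2 =
          -(d : ℝ) * l / 2 - (d : ℝ) * ((j : ℕ) : ℝ) / 2 + k := by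
        intro l
        rw [hk]
        push_cast
        ring
      have hcond : 0 ≤ k ∨ -(d : ℝ) * (-1) / 2 - (d : ℝ) * ((j : ℕ) : ℝ) / 2 < 1 := by
        rcases hm.nonneg_or j with h | ⟨rfl, -⟩
        · exact Or.inl (by omega)
        · have : (0 : ℝ) ≤ ((j : ℕ) : ℝ) := Nat.cast_nonneg _
          exact Or.inr (by push_cast; linarith)
      obtain ⟨c, hc⟩ := exists_tendsto_Gamma_add_intCast_div hcond
      have hlin : Continuous fun l : ℝ => -(d : ℝ) * l / 2 - (d : ℝ) * ((j : ℕ) : ℝ) / 2 := by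
        fun_prop
      refine ⟨c, (hc.comp (tendsto_nhdsWithin_iff.2
        ⟨(hlin.tendsto (-1)).mono_left nhdsWithin_le_nhds, ?_⟩)).congr fun l => ?_⟩
      · filter_upwards [self_mem_nhdsWithin] with l hl
        exact ⟨hshift l ▸ (hl.1 j).2.1, (hl.1 j).2.2.1⟩
      · rw [hshift, Function.comp_apply]
    choose R hR using key
    exact ⟨_, tendsto_add_one_mul_eta ha hR⟩
  · refine ⟨_, ?_, tendsto_add_one_mul_eta (R := fun _ => 1) ha fun j => ?_⟩
    · have hd' : (0 : ℝ) < d := by exact_mod_cast hd0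
      have hj : ∀ j : Fin p, ((j : ℕ) : ℝ) + 1 ≤ p := fun j => by exact_mod_cast j.2
      have hq : (1 : ℝ) ≤ q := by exact_mod_cast hp.trans hpq
      refine mul_ne_zero (mul_ne_zero (mul_ne_zero (mul_ne_zero (by simp)
        (div_ne_zero ?_ ?_)) ha0) (by simp)) ?_
      all_goals
        refine Finset.prod_ne_zero_iff.2 fun j _ => ?_
        try refine inv_ne_zero ?_
        refine (Real.Gamma_pos_of_pos ?_).ne'
        have := hj j
        try push_cast
        nlinarith
    · refine tendsto_const_nhds.congr' ?_
      filter_upwards [self_mem_nhdsWithin] with l hl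
      rw [Int.cast_zero, add_zero,
        div_self (Real.Gamma_ne_zero_of_not_isNonposInt (hl.1 j).2.2.1)]
end

section
/- Let d = 4 and let p, q be integers with q ≥ p ≥ 1, n = p + q. Then: (a) for every integer k ≥ 2 there exists μ ∈ Λ⁺(B) such that |η_μ(λ)| → ∞ as λ → −k/2 (along the punctured neighborhood of −k/2 intersected with the domain of η_μ); and (b) for every real λ₀ not of the form −k/2 with k an integer ≥ 2, and every μ ∈ Λ⁺(B), the function η_μ has a finite limit at λ₀. (That is, in the quaternionic case d = 4 the poles of the cosine-λ transform occur exactly at λ = −1, −3/2, −2, −5/2, −3, ….) -/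
open Filter Set

open Finset in
/-- The functional equation of `Γ`, iterated `n` times. -/
theorem Real.Gamma_add_natCast_eq_prod_mul {s : ℝ} (hs : ¬ IsNonposInt s) (n : ℕ) :
    Real.Gamma (s + n) = (∏ i ∈ range n, (s + i)) * Real.Gamma s := by
  induction n with
  | zero => simp
  | succ n ih =>
    have h : s + n ≠ 0 := fun h => hs ⟨n, by linarith⟩
    rw [Nat.cast_succ, ← add_assoc, Real.Gamma_add_one h, ih, prod_range_succ]
    ring

theorem Real.Gamma_ne_zero_of_not_isNonposInt_s15 {s : ℝ} (hs : ¬ IsNonposInt s) :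
    Real.Gamma s ≠ 0 :=
  Real.Gamma_ne_zero fun k hk => hs ⟨k, hk⟩

/-- The constant factor of the rational function that `eta 4` represents. -/
noncomputable def etaConst (p q : ℕ) (m : Fin p → ℤ) : ℝ :=
  (-1 : ℝ) ^ ((∑ j, m j) / 2) *
    ((∏ j : Fin p,
        Real.Gamma (((4 : ℕ) : ℝ) * ((p : ℝ) + (q : ℝ)) / 2 - ((4 : ℕ) : ℝ) * ((j : ℕ) : ℝ) / 2)) /
      (∏ j : Fin p, Real.Gamma (((4 : ℕ) : ℝ) * (p : ℝ) / 2 - ((4 : ℕ) : ℝ) * ((j : ℕ) : ℝ) / 2)))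

/-- The numerator of the rational function that `eta 4` represents. -/
noncomputable def etaNum (p : ℕ) (N : Fin p → ℕ) (l : ℝ) : ℝ :=
  ∏ j : Fin p, ∏ i ∈ Finset.range (N j), (-2 * l - 2 * ((j : ℕ) : ℝ) + i)

/-- The denominator of the rational function that `eta 4` represents. -/
noncomputable def etaDen (p q : ℕ) (N : Fin p → ℕ) (l : ℝ) : ℝ :=
  ∏ j : Fin p, ∏ i ∈ Finset.range (2 * q + N j), (2 * l + 2 * (p : ℝ) - 2 * ((j : ℕ) : ℝ) + i)

theorem continuous_etaNum (p : ℕ) (N : Fin p → ℕ) : Continuous (etaNum p N) := by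
  unfold etaNum
  fun_prop

theorem continuous_etaDen (p q : ℕ) (N : Fin p → ℕ) : Continuous (etaDen p q N) := by
  unfold etaDen
  fun_prop

theorem etaConst_ne_zero (p q : ℕ) (m : Fin p → ℤ) : etaConst p q m ≠ 0 := by
  unfold etaConst
  have hj (j : Fin p) : ((j : ℕ) : ℝ) < p := by exact_mod_cast j.2
  have hq : (0 : ℝ) ≤ q := q.cast_nonneg
  refine mul_ne_zero (zpow_ne_zero _ (by norm_num)) (div_ne_zero ?_ ?_) <;>
    refine Finset.prod_ne_zero_iff.2 fun j _ => (Real.Gamma_pos_of_pos ?_).ne' <;>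
    push_cast <;> linarith [hj j]

theorem etaDen_ne_zero_of_mem {p q : ℕ} {m : Fin p → ℤ} (N : Fin p → ℕ) {l : ℝ}
    (hl : l ∈ etaDom 4 p q m) : etaDen p q N l ≠ 0 := by
  refine Finset.prod_ne_zero_iff.2 fun j _ => Finset.prod_ne_zero_iff.2 fun i _ h => ?_
  exact (hl j).1 ⟨i, by push_cast; linarith⟩

theorem etaDen_ne_zero {p q : ℕ} (N : Fin p → ℕ) {l : ℝ}
    (hl : ¬ ∃ k : ℕ, 2 ≤ k ∧ l = -(k : ℝ) / 2) : etaDen p q N l ≠ 0 := by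
  refine Finset.prod_ne_zero_iff.2 fun j _ => Finset.prod_ne_zero_iff.2 fun i _ h => ?_
  refine hl ⟨2 * (p - j) + i, by have := j.2; omega, ?_⟩
  push_cast [j.2.le]
  linarith

/-- On its domain, `eta 4` is a rational function. -/
theorem eta_eq_const_mul_num_div_den {p q : ℕ} {m : Fin p → ℤ} {N : Fin p → ℕ}
    (hN : ∀ j, m j = 2 * (N j : ℤ)) {l : ℝ} (hl : l ∈ etaDom 4 p q m) :
    eta 4 p q m l = etaConst p q m * (etaNum p N l / etaDen p q N l) := by
  unfold eta
  rw [mul_div_assoc]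
  refine congrArg (etaConst p q m * ·) ?_
  rw [etaNum, etaDen, ← Finset.prod_div_distrib, ← Finset.prod_div_distrib]
  refine Finset.prod_congr rfl fun j _ => ?_
  obtain ⟨h₁, -, h₃, -⟩ := hl j
  have hg₁ := Real.Gamma_ne_zero_of_not_isNonposInt_s15 h₁
  have hg₃ := Real.Gamma_ne_zero_of_not_isNonposInt_s15 h₃
  have e₂ := Real.Gamma_add_natCast_eq_prod_mul h₃ (N j)
  have e₄ := Real.Gamma_add_natCast_eq_prod_mul h₁ (2 * q + N j)
  have hm : (m j : ℝ) = 2 * (N j : ℝ) := by exact_mod_cast hN j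
  have a₂ : (-((4 : ℕ) : ℝ) * l + (m j : ℝ)) / 2 - ((4 : ℕ) : ℝ) * ((j : ℕ) : ℝ) / 2 =
      -((4 : ℕ) : ℝ) * l / 2 - ((4 : ℕ) : ℝ) * ((j : ℕ) : ℝ) / 2 + (N j : ℝ) := by
    rw [hm]; ring
  have a₄ : (((4 : ℕ) : ℝ) * l + ((4 : ℕ) : ℝ) * ((p : ℝ) + (q : ℝ)) + (m j : ℝ)) / 2 -
      ((4 : ℕ) : ℝ) * ((j : ℕ) : ℝ) / 2 =
      ((4 : ℕ) : ℝ) * (l + (p : ℝ)) / 2 - ((4 : ℕ) : ℝ) * ((j : ℕ) : ℝ) / 2 +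
        ((2 * q + N j : ℕ) : ℝ) := by
    rw [hm]; push_cast; ring
  have b₃ : -((4 : ℕ) : ℝ) * l / 2 - ((4 : ℕ) : ℝ) * ((j : ℕ) : ℝ) / 2 =
      -2 * l - 2 * ((j : ℕ) : ℝ) := by push_cast; ring
  have b₁ : ((4 : ℕ) : ℝ) * (l + (p : ℝ)) / 2 - ((4 : ℕ) : ℝ) * ((j : ℕ) : ℝ) / 2 =
      2 * l + 2 * (p : ℝ) - 2 * ((j : ℕ) : ℝ) := by push_cast; ring
  rw [a₂, a₄, e₂, e₄, b₁, b₃]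
  rw [b₁] at hg₁
  rw [b₃] at hg₃
  rw [mul_left_comm, mul_comm (Real.Gamma (-2 * l - 2 * ((j : ℕ) : ℝ))), mul_assoc,
    mul_div_mul_right _ _ (mul_ne_zero hg₁ hg₃)]

/-- The single-row tuples `(k, 0, …, 0)`; the weights `(2k, 0, …, 0)` detect the poles. -/
def rowWeight (p k : ℕ) (j : Fin p) : ℕ := if (j : ℕ) = 0 then k else 0

theorem lambdaPlus_rowWeight (p q k : ℕ) :
    LambdaPlus 4 p q fun j => 2 * (rowWeight p k j : ℤ) := by
  refine ⟨fun i => dvd_mul_right _ _, fun i j hij => ?_, fun _ i => by positivity⟩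
  have hj : (j : ℕ) ≠ 0 := by have : (i : ℕ) < j := hij; omega
  simp only [rowWeight, hj, if_false, Nat.cast_zero, mul_zero, abs_zero]
  positivity

theorem etaNum_rowWeight_ne_zero (p : ℕ) {k : ℕ} (hk : 0 < k) :
    etaNum p (rowWeight p k) (-(k : ℝ) / 2) ≠ 0 := by
  refine Finset.prod_ne_zero_iff.2 fun j _ => Finset.prod_ne_zero_iff.2 fun i hi => ?_
  have hj : (j : ℕ) = 0 := by
    by_contra h
    simp [rowWeight, h] at hi
  have hk' : (0 : ℝ) < k := by exact_mod_cast hk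
  have hi' : (0 : ℝ) ≤ i := i.cast_nonneg
  rw [hj, Nat.cast_zero]
  exact ne_of_gt (by linarith)

theorem etaDen_rowWeight_eq_zero {p q k : ℕ} (hp : 1 ≤ p) (hpq : p ≤ q) (hk : 2 ≤ k) :
    etaDen p q (rowWeight p k) (-(k : ℝ) / 2) = 0 := by
  rcases le_or_gt (2 * p) k with h | h
  · refine Finset.prod_eq_zero (Finset.mem_univ (⟨0, hp⟩ : Fin p))
      (Finset.prod_eq_zero (i := k - 2 * p) ?_ ?_)
    · simp only [rowWeight, Finset.mem_range, if_true]
      omega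
    · push_cast [h]
      ring
  · refine Finset.prod_eq_zero (Finset.mem_univ (⟨p - 1, by omega⟩ : Fin p))
      (Finset.prod_eq_zero (i := k - 2) ?_ ?_)
    · rw [Finset.mem_range]
      omega
    · push_cast [hk, hp]
      ring

/-- in the quaternionic case d = 4, the poles of the cosine-λ transform
occur exactly at λ = -1, -3/2, -2, -5/2, -3, …, i.e. at λ = -k/2 for integers k ≥ 2. -/
theorem poles_quaternionic_case
    (p q : ℕ) (hp : 1 ≤ p) (hpq : p ≤ q) :
    (∀ k : ℕ, 2 ≤ k →
      ∃ m : Fin p → ℤ, LambdaPlus 4 p q m ∧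
        Tendsto (fun l : ℝ => |eta 4 p q m l|)
          (nhdsWithin (-(k : ℝ) / 2) (etaDom 4 p q m \ {-(k : ℝ) / 2})) atTop) ∧
    (∀ l₀ : ℝ, (¬ ∃ k : ℕ, 2 ≤ k ∧ l₀ = -(k : ℝ) / 2) →
      ∀ m : Fin p → ℤ, LambdaPlus 4 p q m →
        ∃ c : ℝ, Tendsto (eta 4 p q m)
          (nhdsWithin l₀ (etaDom 4 p q m \ {l₀})) (nhds c)) := by
  constructor
  · intro k hk
    set N := rowWeight p k
    set m : Fin p → ℤ := fun j => 2 * (N j : ℤ)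
    refine ⟨m, lambdaPlus_rowWeight p q k, ?_⟩
    have hmem : ∀ᶠ l in nhdsWithin (-(k : ℝ) / 2) (etaDom 4 p q m \ {-(k : ℝ) / 2}),
        l ∈ etaDom 4 p q m := eventually_mem_nhdsWithin.mono fun _ h => h.1
    have hnum : Tendsto (fun l => |etaConst p q m * etaNum p N l|)
        (nhdsWithin (-(k : ℝ) / 2) (etaDom 4 p q m \ {-(k : ℝ) / 2}))
        (nhds |etaConst p q m * etaNum p N (-(k : ℝ) / 2)|) :=
      ((continuous_const.mul (continuous_etaNum p N)).abs.tendsto _).mono_left nhdsWithin_le_nhds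
    have hden : Tendsto (fun l => |etaDen p q N l|)
        (nhdsWithin (-(k : ℝ) / 2) (etaDom 4 p q m \ {-(k : ℝ) / 2}))
        (nhdsWithin 0 (Ioi 0)) := by
      refine tendsto_nhdsWithin_iff.2 ⟨?_, hmem.mono fun l hl =>
        abs_pos.2 (etaDen_ne_zero_of_mem N hl)⟩
      have h := (continuous_etaDen p q N).abs.tendsto (-(k : ℝ) / 2)
      rw [etaDen_rowWeight_eq_zero hp hpq hk, abs_zero] at h
      exact h.mono_left nhdsWithin_le_nhds
    have hpos : 0 < |etaConst p q m * etaNum p N (-(k : ℝ) / 2)| :=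
      abs_pos.2 (mul_ne_zero (etaConst_ne_zero p q m) (etaNum_rowWeight_ne_zero p (by omega)))
    refine (hnum.pos_mul_atTop hpos hden.inv_tendsto_nhdsGT_zero).congr' (hmem.mono fun l hl => ?_)
    have hη := eta_eq_const_mul_num_div_den (m := m) (N := N) (fun _ => rfl) hl
    beta_reduce
    rw [Pi.inv_apply, hη, ← mul_div_assoc, abs_div,
      div_eq_mul_inv]
  · intro l₀ hl₀ m hm
    have hN (j : Fin p) : m j = 2 * ((m j / 2).toNat : ℤ) := by
      have h₁ := hm.1 j
      have h₂ := hm.2.2 (by simp) j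
      omega
    set N : Fin p → ℕ := fun j => (m j / 2).toNat
    refine ⟨etaConst p q m * (etaNum p N l₀ / etaDen p q N l₀), ?_⟩
    have h := (((continuous_etaNum p N).tendsto l₀).div ((continuous_etaDen p q N).tendsto l₀)
      (etaDen_ne_zero N hl₀)).const_mul (etaConst p q m)
    refine (h.mono_left nhdsWithin_le_nhds).congr' (eventually_mem_nhdsWithin.mono fun l hl => ?_)
    exact (eta_eq_const_mul_num_div_den hN hl.1).symm
end
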